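/- arXiv:2601.20579 — 10 statements merged into one kernel-verified Lean document; each statement's English description precedes it below -/
import Mathlib

section
/- Let (Y, d_Y) be a CAT(0) space and let P, Q, R, S be four points of Y. Then d_{PR}² + d_{QS}² ≤ d_{PQ}² + d_{QR}² + d_{RS}² + d_{SP}² − (d_{RS} − d_{PQ})². (Reshetnyak quadrilateral inequality, Lemma 2.3(1).) -/
/-- A geodesic (parametrized on `[0,1]`) in a metric space: the distance between any two
parameter values in `[0,1]` equals `|s - t|` times the distance of the endpoints. -/
def IsGeodesic {Y : Type*} [MetricSpace Y] (γ : ℝ → Y) : Prop :=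
  ∀ s ∈ Set.Icc (0:ℝ) 1, ∀ t ∈ Set.Icc (0:ℝ) 1,
    dist (γ s) (γ t) = |s - t| * dist (γ 0) (γ 1)

/-- A CAT(0) space: a geodesic space in which every geodesic satisfies the CAT(0)
comparison inequality. -/
def IsCAT0Space (Y : Type*) [MetricSpace Y] : Prop :=
  (∀ a b : Y, ∃ γ : ℝ → Y, IsGeodesic γ ∧ γ 0 = a ∧ γ 1 = b) ∧
  (∀ (P : Y) (γ : ℝ → Y), IsGeodesic γ → ∀ t ∈ Set.Icc (0:ℝ) 1,
    dist P (γ t) ^ 2 ≤ (1 - t) * dist P (γ 0) ^ 2 + t * dist P (γ 1) ^ 2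
      - t * (1 - t) * dist (γ 0) (γ 1) ^ 2)

/-- Reshetnyak quadrilateral inequality (Lemma 2.3(1)). -/
theorem reshetnyak_quadrilateral {Y : Type*} [MetricSpace Y] (hY : IsCAT0Space Y)
    (P Q R S : Y) :
    dist P R ^ 2 + dist Q S ^ 2 ≤
      dist P Q ^ 2 + dist Q R ^ 2 + dist R S ^ 2 + dist S P ^ 2
        - (dist R S - dist P Q) ^ 2 := by
  rcases eq_or_lt_of_le (dist_nonneg (x := P) (y := Q)) with hPQ | hPQ
  · obtain rfl := dist_eq_zero.mp hPQ.symm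
    rw [dist_self, dist_comm S P]
    linarith
  rcases eq_or_lt_of_le (dist_nonneg (x := R) (y := S)) with hRS | hRS
  · obtain rfl := dist_eq_zero.mp hRS.symm
    rw [dist_self, dist_comm R P]
    linarith
  obtain ⟨γ, hγ, rfl, rfl⟩ := hY.1 Q S
  -- The parameter at which the diagonal is cut in the ratio of the two opposite sides.
  obtain ⟨t, ht0, ht1, ht⟩ : ∃ t : ℝ, 0 < t ∧ t < 1 ∧
      (1 - t) * dist P (γ 0) = t * dist R (γ 1) := by
    have hsum := add_pos hPQ hRS
    refine ⟨dist P (γ 0) / (dist P (γ 0) + dist R (γ 1)), div_pos hPQ hsum, ?_, ?_⟩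
    · rw [div_lt_one hsum]
      linarith
    · field_simp
      ring
  have hP := hY.2 P γ hγ t ⟨ht0.le, ht1.le⟩
  have hR := hY.2 R γ hγ t ⟨ht0.le, ht1.le⟩
  have htri := dist_triangle_right P R (γ t)
  rw [dist_comm (γ 1) P, dist_comm (γ 0) R]
  have ht1' : 0 < 1 - t := sub_pos.mpr ht1
  have hpos : 0 < t * (1 - t) := mul_pos ht0 ht1'
  have hsq : dist P R ^ 2 ≤ (dist P (γ t) + dist R (γ t)) ^ 2 :=
    pow_le_pow_left₀ dist_nonneg htri 2
  have hsq' := mul_le_mul_of_nonneg_left hsq hpos.le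
  have hP' := mul_le_mul_of_nonneg_left hP ht1'.le
  have hR' := mul_le_mul_of_nonneg_left hR ht0.le
  have hsides : (1 - t) ^ 2 * dist P (γ 0) ^ 2 + t ^ 2 * dist R (γ 1) ^ 2
      = 2 * (t * (1 - t)) * (dist P (γ 0) * dist R (γ 1)) := by
    linear_combination ((1 - t) * dist P (γ 0) - t * dist R (γ 1)) * ht
  refine le_of_mul_le_mul_left ?_ hpos
  linarith [sq_nonneg ((1 - t) * dist P (γ t) - t * dist R (γ t))]
end

section
/- Let (Y, d_Y) be a CAT(0) space, let P, Q, R, S be four points of Y, and let Q_m be the midpoint of Q and R, i.e. d_{QQ_m} = d_{RQ_m} = d_{QR}/2. Then (d_{PS} − d_{QR})·d_{QR} ≥ (d_{PQ_m}² − d_{PQ}² − d_{Q_mQ}²) + (d_{SQ_m}² − d_{SR}² − d_{Q_mR}²). (Lemma 2.3(2).) -/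
/-- In a CAT(0) space, the comparison inequality holds for any metric midpoint. -/
theorem IsCAT0Space.dist_sq_midpoint_le {Y : Type*} [MetricSpace Y] (hY : IsCAT0Space Y)
    {Q R M : Y} (hQ : dist Q M = dist Q R / 2) (hR : dist R M = dist Q R / 2) (P : Y) :
    dist P M ^ 2 ≤ (dist P Q ^ 2 + dist P R ^ 2) / 2 - dist Q R ^ 2 / 4 := by
  obtain ⟨γ, hγ, rfl, rfl⟩ := hY.1 Q R
  have ht : (1 / 2 : ℝ) ∈ Set.Icc (0 : ℝ) 1 := by constructor <;> norm_num
  have hM := hY.2 M γ hγ _ ht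
  rw [dist_comm M (γ 0), dist_comm M (γ 1), hQ, hR] at hM
  have hM' : M = γ (1 / 2) := by
    rw [← dist_eq_zero, ← sq_eq_zero_iff]
    nlinarith [sq_nonneg (dist M (γ (1 / 2)))]
  have hP := hY.2 P γ hγ _ ht
  rw [← hM'] at hP
  linarith

/-- Reshetnyak's quadrilateral inequality, i.e. the Cauchy–Schwarz inequality for the
quasi-inner product of a CAT(0) space. -/
theorem IsCAT0Space.quadrilateral {Y : Type*} [MetricSpace Y] (hY : IsCAT0Space Y)
    (P Q R S : Y) :
    dist P R ^ 2 + dist Q S ^ 2 ≤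
      dist P Q ^ 2 + dist R S ^ 2 + 2 * (dist P S * dist Q R) := by
  rcases eq_or_ne P S with rfl | hPS
  · simp [dist_comm, add_comm]
  rcases eq_or_ne Q R with rfl | hQR
  · simp
  obtain ⟨γ, hγ, rfl, rfl⟩ := hY.1 Q S
  have ha : 0 < dist P (γ 1) := dist_pos.mpr hPS
  have hb : 0 < dist (γ 0) R := dist_pos.mpr hQR
  set a := dist P (γ 1)
  set b := dist (γ 0) R with hb_def
  have ht : b / (a + b) ∈ Set.Icc (0 : ℝ) 1 :=
    ⟨by positivity, (div_le_one (by positivity)).mpr (by linarith)⟩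
  have hP := hY.2 P γ hγ _ ht
  have hR := hY.2 R γ hγ _ ht
  rw [dist_comm R (γ 0), ← hb_def] at hR
  have htri := dist_triangle_right P R (γ (b / (a + b)))
  set x := dist P (γ (b / (a + b)))
  set y := dist R (γ (b / (a + b)))
  have hPR : dist P R ^ 2 ≤ (a + b) / a * x ^ 2 + (a + b) / b * y ^ 2 := by
    have h1 : dist P R ^ 2 ≤ (x + y) ^ 2 := by gcongr
    have h2 : (a + b) / a * x ^ 2 + (a + b) / b * y ^ 2 - (x + y) ^ 2 =
        (b * x - a * y) ^ 2 / (a * b) := by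
      field_simp
      ring
    have h3 : 0 ≤ (b * x - a * y) ^ 2 / (a * b) := by positivity
    linarith
  calc dist P R ^ 2 + dist (γ 0) (γ 1) ^ 2
      ≤ (a + b) / a * x ^ 2 + (a + b) / b * y ^ 2 + dist (γ 0) (γ 1) ^ 2 := by gcongr
    _ ≤ (a + b) / a * ((1 - b / (a + b)) * dist P (γ 0) ^ 2 + b / (a + b) * a ^ 2
          - b / (a + b) * (1 - b / (a + b)) * dist (γ 0) (γ 1) ^ 2)
        + (a + b) / b * ((1 - b / (a + b)) * b ^ 2 + b / (a + b) * dist R (γ 1) ^ 2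
          - b / (a + b) * (1 - b / (a + b)) * dist (γ 0) (γ 1) ^ 2)
        + dist (γ 0) (γ 1) ^ 2 := by gcongr
    _ = dist P (γ 0) ^ 2 + dist R (γ 1) ^ 2 + 2 * (a * b) := by
      field_simp
      ring

/-- Lemma 2.3(2): the midpoint inequality. -/
theorem midpoint_inequality {Y : Type*} [MetricSpace Y] (hY : IsCAT0Space Y)
    (P Q R S Qm : Y)
    (hQm1 : dist Q Qm = dist Q R / 2) (hQm2 : dist R Qm = dist Q R / 2) :
    (dist P S - dist Q R) * dist Q R ≥
      (dist P Qm ^ 2 - dist P Q ^ 2 - dist Qm Q ^ 2)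
        + (dist S Qm ^ 2 - dist S R ^ 2 - dist Qm R ^ 2) := by
  have hP := hY.dist_sq_midpoint_le hQm1 hQm2 P
  have hS := hY.dist_sq_midpoint_le hQm1 hQm2 S
  have hquad := hY.quadrilateral P Q R S
  rw [dist_comm Qm Q, dist_comm Qm R, hQm1, hQm2]
  rw [dist_comm S Q, dist_comm S R] at hS
  rw [dist_comm S R]
  linarith
end

section
/- Let (Y, d_Y) be a CAT(0) space, let P, Q, R, S be four points of Y, let λ, μ ∈ (0,1), let P_λ be the point on the geodesic from P to S with d_{PP_λ} = λ·d_{PS}, and let Q_μ be the point on the geodesic from Q to R with d_{QQ_μ} = μ·d_{QR}. Then d_{P_λQ_μ}² ≤ 2(1−λ)·d_{PQ}² + 2λ·d_{RS}² + 2|λ−μ|²·d_{QR}². (Lemma 2.3(4), inequality (pq-2).) -/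
/-- Two geodesics issuing from a common point spread at most linearly. -/
theorem IsCAT0Space.dist_le_of_common_source {Y : Type*} [MetricSpace Y] (hY : IsCAT0Space Y)
    {γ σ : ℝ → Y} (hγ : IsGeodesic γ) (hσ : IsGeodesic σ) (h : γ 0 = σ 0)
    {t : ℝ} (ht : t ∈ Set.Icc (0:ℝ) 1) :
    dist (γ t) (σ t) ≤ t * dist (γ 1) (σ 1) := by
  have h1 := hY.2 (γ t) σ hσ t ht
  have h2 := hY.2 (σ 1) γ hγ t ht
  have h3 := hγ t ht 0 (by simp)
  rw [sub_zero, abs_of_nonneg ht.1] at h3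
  rw [← h, h3] at h1
  rw [dist_comm (σ 1) (γ t), dist_comm (σ 1) (γ 0), dist_comm (σ 1) (γ 1)] at h2
  refine abs_le_of_sq_le_sq' ?_ (mul_nonneg ht.1 dist_nonneg) |>.2
  linarith [mul_le_mul_of_nonneg_left h2 ht.1]

/-- Reversing a geodesic gives a geodesic. -/
theorem IsGeodesic.reverse {Y : Type*} [MetricSpace Y] {γ : ℝ → Y} (hγ : IsGeodesic γ) :
    IsGeodesic fun t => γ (1 - t) := by
  intro s hs t ht
  have h := hγ (1 - s) ⟨by linarith [hs.2], by linarith [hs.1]⟩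
    (1 - t) ⟨by linarith [ht.2], by linarith [ht.1]⟩
  simp only [sub_zero, sub_self]
  rw [h, dist_comm (γ 1), sub_sub_sub_cancel_left, abs_sub_comm]

/-- Convexity of the distance between two geodesics of a CAT(0) space. -/
theorem IsCAT0Space.dist_le_convex_combination {Y : Type*} [MetricSpace Y] (hY : IsCAT0Space Y)
    {γ σ : ℝ → Y} (hγ : IsGeodesic γ) (hσ : IsGeodesic σ) {t : ℝ} (ht : t ∈ Set.Icc (0:ℝ) 1) :
    dist (γ t) (σ t) ≤ (1 - t) * dist (γ 0) (σ 0) + t * dist (γ 1) (σ 1) := by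
  obtain ⟨τ, hτ, hτ0, hτ1⟩ := hY.1 (γ 0) (σ 1)
  have h1 := hY.dist_le_of_common_source hγ hτ hτ0.symm ht
  have h2 := hY.dist_le_of_common_source hτ.reverse hσ.reverse (by simpa using hτ1)
    (t := 1 - t) ⟨by linarith [ht.2], by linarith [ht.1]⟩
  simp only [sub_sub_cancel, sub_self, hτ0] at h2
  rw [hτ1] at h1
  linarith [dist_triangle (γ t) (τ t) (σ t)]

/-- Lemma 2.3(4), inequality (pq-2). -/
theorem cat0_two_geodesics_pq2 {Y : Type*} [MetricSpace Y] (hY : IsCAT0Space Y)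
    (P Q R S : Y) (l m : ℝ) (hl : l ∈ Set.Ioo (0:ℝ) 1) (hm : m ∈ Set.Ioo (0:ℝ) 1)
    (γ : ℝ → Y) (hγ : IsGeodesic γ) (hγ0 : γ 0 = P) (hγ1 : γ 1 = S)
    (σ : ℝ → Y) (hσ : IsGeodesic σ) (hσ0 : σ 0 = Q) (hσ1 : σ 1 = R) :
    dist (γ l) (σ m) ^ 2 ≤
      2 * (1 - l) * dist P Q ^ 2 + 2 * l * dist R S ^ 2
        + 2 * |l - m| ^ 2 * dist Q R ^ 2 := by
  subst hγ0 hγ1 hσ0 hσ1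
  have hl' : l ∈ Set.Icc (0:ℝ) 1 := Set.Ioo_subset_Icc_self hl
  have h1 := hY.dist_le_convex_combination hγ hσ hl'
  have h2 := hσ l hl' m (Set.Ioo_subset_Icc_self hm)
  have h3 := dist_triangle (γ l) (σ l) (σ m)
  rw [dist_comm (σ 1) (γ 1)]
  set a := dist (γ 0) (σ 0)
  set b := dist (γ 1) (σ 1)
  set k := |l - m| * dist (σ 0) (σ 1)
  have h4 : dist (γ l) (σ m) ^ 2 ≤ ((1 - l) * a + l * b + k) ^ 2 :=
    pow_le_pow_left₀ dist_nonneg (by linarith) 2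
  have h5 : ((1 - l) * a + l * b) ^ 2 ≤ (1 - l) * a ^ 2 + l * b ^ 2 := by
    have := mul_nonneg (mul_nonneg hl'.1 (sub_nonneg.2 hl'.2)) (sq_nonneg (a - b))
    linarith
  have h6 : k ^ 2 = |l - m| ^ 2 * dist (σ 0) (σ 1) ^ 2 := mul_pow _ _ 2
  linarith [sq_nonneg ((1 - l) * a + l * b - k)]
end

section
/- Let (Y, d_Y) be a CAT(0) space, let P, Q, R, S be four points of Y, and let λ, μ ∈ [0,1]. Let P_λ and P_{1−λ} be the points on the geodesic from P to S with d_{PP_λ} = λ·d_{PS} and d_{PP_{1−λ}} = (1−λ)·d_{PS}, and let Q_μ and Q_{1−μ} be the points on the geodesic from Q to R with d_{QQ_μ} = μ·d_{QR} and d_{QQ_{1−μ}} = (1−μ)·d_{QR}. Then d_{P_λQ_μ}² + d_{P_{1−λ}Q_{1−μ}}² ≤ [μ(1−λ) + λ(1−μ)]·(d_{PR}² + d_{QS}²) + [(1−λ)(1−μ) + λμ]·(d_{PQ}² + d_{RS}²) − 2λ(1−λ)·d_{PS}² − 2μ(1−μ)·d_{QR}². (Proved in step (iii) of the proof of Lemma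 3.2.) -/
/-- In a CAT(0) space, the distance between points of two geodesics is controlled by the mutual
distances of the four endpoints. -/
theorem IsCAT0Space.dist_sq_le {Y : Type*} [MetricSpace Y] (hY : IsCAT0Space Y)
    {γ σ : ℝ → Y} (hγ : IsGeodesic γ) (hσ : IsGeodesic σ) {s t : ℝ}
    (hs : s ∈ Set.Icc (0:ℝ) 1) (ht : t ∈ Set.Icc (0:ℝ) 1) :
    dist (γ s) (σ t) ^ 2 ≤
      (1 - s) * (1 - t) * dist (γ 0) (σ 0) ^ 2 + s * (1 - t) * dist (σ 0) (γ 1) ^ 2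
        + (1 - s) * t * dist (γ 0) (σ 1) ^ 2 + s * t * dist (σ 1) (γ 1) ^ 2
        - s * (1 - s) * dist (γ 0) (γ 1) ^ 2 - t * (1 - t) * dist (σ 0) (σ 1) ^ 2 := by
  have h := hY.2 (γ s) σ hσ t ht
  have h0 := mul_le_mul_of_nonneg_left (hY.2 (σ 0) γ hγ s hs) (sub_nonneg.2 ht.2)
  have h1 := mul_le_mul_of_nonneg_left (hY.2 (σ 1) γ hγ s hs) ht.1
  rw [dist_comm (γ s) (σ 0), dist_comm (γ s) (σ 1)] at h
  rw [dist_comm (σ 0) (γ 0)] at h0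
  rw [dist_comm (σ 1) (γ 0)] at h1
  linarith

/-- Step (iii) of the proof of Lemma 3.2, first four-point inequality. -/
theorem cat0_four_point_sum {Y : Type*} [MetricSpace Y] (hY : IsCAT0Space Y)
    (P Q R S : Y) (l m : ℝ) (hl : l ∈ Set.Icc (0:ℝ) 1) (hm : m ∈ Set.Icc (0:ℝ) 1)
    (γ : ℝ → Y) (hγ : IsGeodesic γ) (hγ0 : γ 0 = P) (hγ1 : γ 1 = S)
    (σ : ℝ → Y) (hσ : IsGeodesic σ) (hσ0 : σ 0 = Q) (hσ1 : σ 1 = R) :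
    dist (γ l) (σ m) ^ 2 + dist (γ (1 - l)) (σ (1 - m)) ^ 2 ≤
      (m * (1 - l) + l * (1 - m)) * (dist P R ^ 2 + dist Q S ^ 2)
        + ((1 - l) * (1 - m) + l * m) * (dist P Q ^ 2 + dist R S ^ 2)
        - 2 * l * (1 - l) * dist P S ^ 2 - 2 * m * (1 - m) * dist Q R ^ 2 := by
  have h := hY.dist_sq_le hγ hσ hl hm
  have h' := hY.dist_sq_le hγ hσ (s := 1 - l) (t := 1 - m)
    ⟨sub_nonneg.2 hl.2, sub_le_self 1 hl.1⟩ ⟨sub_nonneg.2 hm.2, sub_le_self 1 hm.1⟩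
  rw [hγ0, hγ1, hσ0, hσ1] at h h'
  linarith
end

section
/- Let (Y, d_Y) be a CAT(0) space, let P, Q, R, S be four points of Y, and let λ ∈ [0,1]. Let P_λ be the point on the geodesic from P to S with d_{PP_λ} = λ·d_{PS}, and let S_λ be the point on the same geodesic with d_{SS_λ} = λ·d_{PS}. Then λ·(d_{PS}² − d_{QR}²) ≤ (d_{P_λP}² + d_{PQ}² − d_{P_λQ}²) + (d_{S_λS}² + d_{SR}² − d_{S_λR}²). (The pointwise CAT(0) inequality underlying Lemma 3.3, obtained by summing the two comparison inequalities for P_λ and S_λ with the Reshetnyak quadrilateral inequality.) -/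
/-- The quadrilateral inequality in a CAT(0) space: the sum of the squared diagonals is at most
the sum of the squared sides. -/
theorem IsCAT0Space.quadrilateral_inequality {Y : Type*} [MetricSpace Y] (hY : IsCAT0Space Y)
    (P Q R S : Y) :
    dist P R ^ 2 + dist Q S ^ 2 ≤
      dist P Q ^ 2 + dist Q R ^ 2 + dist R S ^ 2 + dist S P ^ 2 := by
  obtain ⟨σ, hσ, rfl, rfl⟩ := hY.1 P R
  have hQ := hY.2 Q σ hσ (1 / 2) (by norm_num)
  have hS := hY.2 S σ hσ (1 / 2) (by norm_num)
  have htri := dist_triangle_right Q S (σ (1 / 2))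
  have hsq := pow_le_pow_left₀ dist_nonneg htri 2
  rw [dist_comm (σ 0) Q, dist_comm (σ 1) S]
  nlinarith [sq_nonneg (dist Q (σ (1 / 2)) - dist S (σ (1 / 2)))]

/-- The pointwise CAT(0) inequality underlying Lemma 3.3. -/
theorem cat0_lemma33_pointwise {Y : Type*} [MetricSpace Y] (hY : IsCAT0Space Y)
    (P Q R S : Y) (l : ℝ) (hl : l ∈ Set.Icc (0:ℝ) 1)
    (γ : ℝ → Y) (hγ : IsGeodesic γ) (hγ0 : γ 0 = P) (hγ1 : γ 1 = S) :
    l * (dist P S ^ 2 - dist Q R ^ 2) ≤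
      (dist (γ l) P ^ 2 + dist P Q ^ 2 - dist (γ l) Q ^ 2)
        + (dist (γ (1 - l)) S ^ 2 + dist S R ^ 2 - dist (γ (1 - l)) R ^ 2) := by
  have hl' : 1 - l ∈ Set.Icc (0:ℝ) 1 := ⟨by linarith [hl.2], by linarith [hl.1]⟩
  have hP := hγ l hl 0 (by norm_num)
  have hS := hγ (1 - l) hl' 1 (by norm_num)
  have hQ := hY.2 Q γ hγ l hl
  have hR := hY.2 R γ hγ (1 - l) hl'
  have hquad := mul_le_mul_of_nonneg_left (hY.quadrilateral_inequality P Q R S) hl.1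
  rw [hγ0, hγ1] at hP hS hQ hR
  rw [hP, hS, mul_pow, mul_pow, sq_abs, sq_abs, dist_comm (γ l) Q, dist_comm (γ (1 - l)) R]
  rw [dist_comm Q P] at hQ
  rw [dist_comm R P, dist_comm R S] at hR
  rw [dist_comm R S, dist_comm S P] at hquad
  linarith
end

section
/- Let n ≥ 1, let Ω ⊂ ℝⁿ be a bounded open set, let T > 0, and let f ∈ L¹(Ω × (0,T)); extend f by zero to all of ℝⁿ × ℝ. For τ > 0 let p_τ(x,y) := (4πτ)^{−n/2}·exp(−|x−y|²/(4τ)) be the Euclidean heat kernel and set H_τ[g](x) := ∫_{ℝⁿ} p_τ(x,y)·g(y) dy. Then for Lebesgue-almost every (x,t) ∈ Ω × (0,T), lim_{s→0⁺} (1/s)·∫₀ˢ H_τ[f(·, t−τ)](x) dτ = f(x,t). (Euclidean case of Proposition 6.3; the paper's proof uses only the L¹-contraction property of the heat semigroup and approximation of f by continuous functions.) -/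
open MeasureTheory Filter

/-- The Euclidean heat kernel `p_τ(x,y) = (4πτ)^{-n/2} exp(-|x-y|²/(4τ))`. -/
noncomputable def euclHeatKernel (n : ℕ) (τ : ℝ)
    (x y : EuclideanSpace ℝ (Fin n)) : ℝ :=
  (4 * Real.pi * τ) ^ (-(n : ℝ) / 2) * Real.exp (-‖x - y‖ ^ 2 / (4 * τ))

open Topology Metric

theorem euclHeatKernel_nonneg (n : ℕ) {τ : ℝ} (hτ : 0 < τ) (x y : EuclideanSpace ℝ (Fin n)) :
    0 ≤ euclHeatKernel n τ x y := by
  unfold euclHeatKernel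
  positivity

theorem integral_euclHeatKernel (n : ℕ) {τ : ℝ} (hτ : 0 < τ) (x : EuclideanSpace ℝ (Fin n)) :
    ∫ y, euclHeatKernel n τ x y = 1 := by
  unfold euclHeatKernel
  rw [integral_const_mul]
  have h := integral_sub_left_eq_self
    (fun z : EuclideanSpace ℝ (Fin n) => Real.exp (-(1 / (4 * τ)) * ‖z‖ ^ 2)) volume x
  rw [GaussianFourier.integral_rexp_neg_mul_sq_norm (by positivity)] at h
  have h' : ∀ y, Real.exp (-‖x - y‖ ^ 2 / (4 * τ)) =
      Real.exp (-(1 / (4 * τ)) * ‖x - y‖ ^ 2) := fun y => by congr 1; ring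
  simp_rw [h', h]
  rw [finrank_euclideanSpace_fin, show Real.pi / (1 / (4 * τ)) = 4 * Real.pi * τ by field_simp,
    ← Real.rpow_add (by positivity), neg_div, neg_add_cancel, Real.rpow_zero]

theorem integrable_euclHeatKernel (n : ℕ) {τ : ℝ} (hτ : 0 < τ) (x : EuclideanSpace ℝ (Fin n)) :
    Integrable (euclHeatKernel n τ x) :=
  Integrable.of_integral_ne_zero (by rw [integral_euclHeatKernel n hτ x]; exact one_ne_zero)

theorem measurable_euclHeatKernel (n : ℕ) (x : EuclideanSpace ℝ (Fin n)) :
    Measurable (fun q : EuclideanSpace ℝ (Fin n) × ℝ => euclHeatKernel n q.2 x q.1) := by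
  unfold euclHeatKernel
  fun_prop

/-- The heat kernel is dominated by `r⁻ⁿ (τ / r²)²`, where `r = √(|x - y|² + τ)` is the
parabolic distance to the pole. -/
theorem exists_euclHeatKernel_mul_pow_le (n : ℕ) : ∃ C : ℝ, 0 ≤ C ∧
    ∀ (τ r : ℝ) (x y : EuclideanSpace ℝ (Fin n)), 0 < τ → 0 < r → r ^ 2 = ‖x - y‖ ^ 2 + τ →
      euclHeatKernel n τ x y * r ^ n ≤ C * (τ / r ^ 2) ^ 2 := by
  refine ⟨Real.exp (1 / 4) * (4 ^ (n + 2) * (n + 2).factorial), by positivity, ?_⟩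
  intro τ r x y hτ hr h
  set u : ℝ := r ^ 2 / τ with hu
  have hu1 : 1 ≤ u := by
    rw [hu, le_div_iff₀ hτ]
    nlinarith [sq_nonneg ‖x - y‖]
  have hexp : Real.exp (-‖x - y‖ ^ 2 / (4 * τ)) = Real.exp (1 / 4) * Real.exp (-(u / 4)) := by
    rw [← Real.exp_add, hu, h]
    congr 1
    field_simp
    ring
  have hpow : (4 * Real.pi * τ) ^ (-(n : ℝ) / 2) * r ^ n ≤ u ^ n := by
    have h1 : (4 * Real.pi * τ) ^ (-(n : ℝ) / 2) ≤ τ ^ (-(n : ℝ) / 2) := by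
      apply Real.rpow_le_rpow_of_nonpos hτ
      · nlinarith [Real.pi_gt_three]
      · have : (0 : ℝ) ≤ n := n.cast_nonneg
        linarith
    have h2 : r ^ n = (r ^ 2) ^ ((n : ℝ) / 2) := by
      rw [← Real.rpow_natCast r 2, ← Real.rpow_mul hr.le, ← Real.rpow_natCast]
      congr 1
      push_cast
      ring
    calc _ ≤ τ ^ (-(n : ℝ) / 2) * (r ^ 2) ^ ((n : ℝ) / 2) := by rw [h2]; gcongr
      _ = u ^ ((n : ℝ) / 2) := by
        rw [hu, Real.div_rpow (by positivity) hτ.le, neg_div, Real.rpow_neg hτ.le]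
        ring
      _ ≤ u ^ (n : ℝ) := by
        apply Real.rpow_le_rpow_of_exponent_le hu1
        have : (0 : ℝ) ≤ n := n.cast_nonneg
        linarith
      _ = u ^ n := Real.rpow_natCast _ _
  have hfac : u ^ (n + 2) * Real.exp (-(u / 4)) ≤ 4 ^ (n + 2) * (n + 2).factorial := by
    have := Real.pow_div_factorial_le_exp (u / 4) (by positivity) (n + 2)
    rw [Real.exp_neg, ← div_eq_mul_inv, div_le_iff₀ (Real.exp_pos _)]
    rw [div_le_iff₀ (by positivity), div_pow, div_le_iff₀ (by positivity)] at this
    linarith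
  have hinv : τ / r ^ 2 = u⁻¹ := by rw [hu, inv_div]
  rw [hinv, inv_pow, ← div_eq_mul_inv, le_div_iff₀ (by positivity), euclHeatKernel, hexp]
  calc _ = Real.exp (1 / 4) * (((4 * Real.pi * τ) ^ (-(n : ℝ) / 2) * r ^ n) *
        (u ^ 2 * Real.exp (-(u / 4)))) := by ring
    _ ≤ Real.exp (1 / 4) * (u ^ n * (u ^ 2 * Real.exp (-(u / 4)))) := by gcongr
    _ = Real.exp (1 / 4) * (u ^ (n + 2) * Real.exp (-(u / 4))) := by ring
    _ ≤ _ := by gcongr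

/-- At every point, the normalised kernel `p_τ / s` with `0 < τ < s` is controlled by one of the
dyadic parabolic cylinders of radius `2 ^ (k + 1) * √s`, with a weight decaying geometrically in `|k|`. -/
theorem exists_euclHeatKernel_dyadic_bound (n : ℕ) : ∃ C : ℝ, 0 ≤ C ∧
    ∀ (s τ : ℝ) (x y : EuclideanSpace ℝ (Fin n)), 0 < τ → τ < s →
      ∃ k : ℤ, s⁻¹ * euclHeatKernel n τ x y ≤
          C * (1 / 4) ^ k.natAbs / (2 ^ (k + 1) * √s) ^ (n + 2) ∧
        ‖x - y‖ ≤ 2 ^ (k + 1) * √s ∧ τ ≤ (2 ^ (k + 1) * √s) ^ 2 := by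
  obtain ⟨C, hC, hbound⟩ := exists_euclHeatKernel_mul_pow_le n
  refine ⟨C * 2 ^ (n + 2), by positivity, fun s τ x y hτ hs => ?_⟩
  have hs0 : 0 < s := hτ.trans hs
  have hss : 0 < √s := Real.sqrt_pos.2 hs0
  set r : ℝ := √(‖x - y‖ ^ 2 + τ) with hr
  have hr0 : 0 < r := Real.sqrt_pos.2 (by positivity)
  have hr2 : r ^ 2 = ‖x - y‖ ^ 2 + τ := Real.sq_sqrt (by positivity)
  obtain ⟨k, hk1, hk2⟩ := exists_mem_Ioc_zpow (div_pos hr0 hss) (one_lt_two (α := ℝ))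
  rw [lt_div_iff₀ hss] at hk1
  rw [div_le_iff₀ hss] at hk2
  have hK := hbound τ r x y hτ hr0 hr2
  have hK0 := euclHeatKernel_nonneg n hτ x y
  refine ⟨k, ?_, ?_, ?_⟩
  · set ρ : ℝ := 2 ^ k * √s with hρ
    have hρ0 : 0 < ρ := by positivity
    have hρ2 : ρ ^ 2 = 4 ^ k * s := by
      rw [hρ, mul_pow, Real.sq_sqrt hs0.le, ← zpow_natCast, zpow_comm]
      norm_num
    have h2ρ : (2 : ℝ) ^ (k + 1) * √s = 2 * ρ := by
      rw [hρ, zpow_add₀ two_ne_zero]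
      ring
    have hρr : ρ ^ 2 ≤ r ^ 2 := by gcongr
    have hw : (4 : ℝ) ^ k * (τ / r ^ 2) ^ 2 ≤ (1 / 4) ^ k.natAbs := by
      rcases le_total 0 k with h | h
      · have h1 : τ / r ^ 2 ≤ ((4 : ℝ) ^ k)⁻¹ := by
          rw [div_le_iff₀ (by positivity), inv_mul_eq_div, le_div_iff₀ (by positivity)]
          nlinarith [zpow_pos (show (0 : ℝ) < 4 by norm_num) k]
        have h2 : ((1 : ℝ) / 4) ^ k.natAbs = ((4 : ℝ) ^ k)⁻¹ := by
          rw [← zpow_natCast, Int.natCast_natAbs, abs_of_nonneg h, one_div, inv_zpow]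
        rw [h2]
        calc (4 : ℝ) ^ k * (τ / r ^ 2) ^ 2 ≤ 4 ^ k * (((4 : ℝ) ^ k)⁻¹) ^ 2 := by gcongr
          _ = _ := by field_simp
      · have h1 : τ / r ^ 2 ≤ 1 := by
          rw [div_le_one (by positivity), hr2]
          nlinarith [sq_nonneg ‖x - y‖]
        have h2 : ((1 : ℝ) / 4) ^ k.natAbs = (4 : ℝ) ^ k := by
          rw [← zpow_natCast, Int.natCast_natAbs, abs_of_nonpos h, one_div, inv_zpow', neg_neg]
        rw [h2]
        exact mul_le_of_le_one_right (by positivity) (pow_le_one₀ (by positivity) h1)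
    rw [h2ρ, mul_pow, mul_right_comm, mul_comm ((2 : ℝ) ^ (n + 2)) (ρ ^ (n + 2)),
      mul_div_mul_right _ _ (by positivity),
      le_div_iff₀ (by positivity)]
    calc s⁻¹ * euclHeatKernel n τ x y * ρ ^ (n + 2)
        = 4 ^ k * (euclHeatKernel n τ x y * ρ ^ n) := by
          rw [pow_add, hρ2]
          field_simp
      _ ≤ 4 ^ k * (euclHeatKernel n τ x y * r ^ n) := by gcongr
      _ ≤ 4 ^ k * (C * (τ / r ^ 2) ^ 2) := by gcongr
      _ = C * (4 ^ k * (τ / r ^ 2) ^ 2) := by ring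
      _ ≤ _ := by gcongr
  · refine le_trans ?_ hk2
    exact abs_le_of_sq_le_sq' (by linarith) hr0.le |>.2
  · refine le_trans ?_ (pow_le_pow_left₀ hr0.le hk2 2)
    nlinarith [sq_nonneg ‖x - y‖]

/-- **Lebesgue differentiation theorem** for parabolic cylinders: they are the balls of the product
of `E` with the `1 / 2`-snowflake of `ℝ`, for which the product measure is doubling. -/
theorem ae_tendsto_integral_parabolicCylinder {E : Type*} [NormedAddCommGroup E]
    [NormedSpace ℝ E] [FiniteDimensional ℝ E] [MeasurableSpace E] [BorelSpace E]
    (μ : Measure E) [μ.IsAddHaarMeasure] {F : E × ℝ → ℝ} (hF : Integrable F (μ.prod volume)) :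
    ∀ᵐ p ∂(μ.prod volume), Tendsto
      (fun r : ℝ => (∫ q in closedBall p.1 r ×ˢ closedBall p.2 (r ^ 2), ‖F q - F p‖ ∂(μ.prod volume))
        / r ^ (Module.finrank ℝ E + 2)) (𝓝[>] 0) (𝓝 0) := by
  let S := Snowflaking ℝ (1 / 2) (by norm_num) (by norm_num)
  let : MeasurableSpace S := borel S
  have : BorelSpace S := ⟨rfl⟩
  let e : ℝ ≃ₜ S := (Snowflaking.homeomorph (X := ℝ) (α := 1 / 2) (hα₀ := by norm_num)
    (hα₁ := by norm_num)).symm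
  have heball : ∀ (t r : ℝ), 0 ≤ r → e ⁻¹' (closedBall (e t) r) = closedBall t (r ^ 2) := by
    intro t r hr
    have := Snowflaking.preimage_toSnowflaking_closedBall (X := ℝ) (α := 1 / 2)
      (hα₀ := by norm_num) (hα₁ := by norm_num) (e t) hr
    refine this.trans ?_
    congr 1
    norm_num
  let ν : Measure S := volume.map e
  have heν : MeasurePreserving e volume ν := e.continuous.measurable.measurePreserving volume
  let φ : E × ℝ ≃ₜ E × S := (Homeomorph.refl E).prodCongr e
  have hφ : MeasurePreserving φ (μ.prod volume) (μ.prod ν) :=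
    (MeasurePreserving.id μ).prod heν
  have hφe : MeasurableEmbedding φ := φ.measurableEmbedding
  have hφball : ∀ (p : E × ℝ) (r : ℝ), 0 ≤ r →
      φ ⁻¹' (closedBall (φ p) r) = closedBall p.1 r ×ˢ closedBall p.2 (r ^ 2) := by
    intro p r hr
    rw [← heball p.2 r hr]
    ext q
    simp [φ, Prod.dist_eq]
  set c : ENNReal := μ (ball 0 1) with hc
  have hc0 : c ≠ 0 := (measure_ball_pos μ 0 one_pos).ne'
  have hct : c ≠ ⊤ := measure_ball_lt_top.ne
  have hvol : ∀ (p : E × ℝ) (r : ℝ), 0 ≤ r → (μ.prod ν) (closedBall (φ p) r) =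
      ENNReal.ofReal (2 * r ^ (Module.finrank ℝ E + 2)) * c := by
    intro p r hr
    rw [← hφ.measure_preimage_emb hφe, hφball p r hr, Measure.prod_prod,
      Measure.addHaar_closedBall μ _ hr, Real.volume_closedBall, mul_right_comm,
      ← ENNReal.ofReal_mul (by positivity)]
    congr 2
    ring
  have : IsLocallyFiniteMeasure (μ.prod ν) := by
    refine ⟨fun z => ?_⟩
    obtain ⟨p, rfl⟩ := φ.surjective z
    refine ⟨closedBall (φ p) 1, closedBall_mem_nhds _ one_pos, ?_⟩
    rw [hvol p 1 zero_le_one]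
    exact ENNReal.mul_lt_top ENNReal.ofReal_lt_top hct.lt_top
  have : IsUnifLocDoublingMeasure (μ.prod ν) := by
    refine ⟨⟨2 ^ (Module.finrank ℝ E + 2), ?_⟩⟩
    filter_upwards [self_mem_nhdsWithin] with r hr z
    have hr : 0 < r := hr
    obtain ⟨p, rfl⟩ := φ.surjective z
    rw [hvol p _ (by positivity), hvol p _ hr.le, ← mul_assoc]
    gcongr
    rw [show ((2 ^ (Module.finrank ℝ E + 2) : NNReal) : ENNReal)
      = ENNReal.ofReal (2 ^ (Module.finrank ℝ E + 2)) by
        rw [ENNReal.ofReal_pow (by norm_num)]; simp, ← ENNReal.ofReal_mul (by positivity)]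
    apply ENNReal.ofReal_le_ofReal
    rw [mul_pow]
    linarith
  have hG : Integrable (F ∘ φ.symm) (μ.prod ν) := by
    rw [← hφ.integrable_comp_emb hφe]
    simpa [Function.comp_def] using hF
  have key := hφ.quasiMeasurePreserving.ae
    (IsUnifLocDoublingMeasure.ae_tendsto_average_norm_sub (μ.prod ν) hG.locallyIntegrable 1)
  filter_upwards [key] with p hp
  have h1 := hp (l := 𝓝[>] (0 : ℝ)) (fun _ => φ p) id tendsto_id (by
    filter_upwards [self_mem_nhdsWithin] with r hr
    have hr : 0 < r := hr
    simp [hr.le])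
  have h2 := h1.const_mul (2 * c.toReal)
  rw [mul_zero] at h2
  refine h2.congr' ?_
  filter_upwards [self_mem_nhdsWithin] with r hr
  have hr : 0 < r := hr
  have hcr : 0 < c.toReal := ENNReal.toReal_pos hc0 hct
  rw [setAverage_eq, measureReal_def, id, hvol p r hr.le, ← hφball p r hr.le,
    ← hφ.setIntegral_preimage_emb hφe, ENNReal.toReal_mul,
    ENNReal.toReal_ofReal (by positivity)]
  simp only [Function.comp_apply, Homeomorph.symm_apply_apply, smul_eq_mul]
  field_simp

theorem tendsto_tsum_dyadic {a : ℝ → ℝ} {B : ℝ} (hB : ∀ r, 0 < r → ‖a r‖ ≤ B)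
    (ha : Tendsto a (𝓝[>] 0) (𝓝 0)) :
    (∀ s : ℝ, 0 < s → Summable fun k : ℤ => (1 / 4 : ℝ) ^ k.natAbs * a (2 ^ (k + 1) * √s)) ∧
    Tendsto (fun s : ℝ => ∑' k : ℤ, (1 / 4 : ℝ) ^ k.natAbs * a (2 ^ (k + 1) * √s))
      (𝓝[>] 0) (𝓝 0) := by
  have hsum : Summable fun k : ℤ => (1 / 4 : ℝ) ^ k.natAbs * B := by
    apply Summable.mul_right
    have hg := summable_geometric_of_lt_one (r := (1 / 4 : ℝ)) (by norm_num) (by norm_num)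
    exact Summable.of_nat_of_neg (by simpa using hg) (by simpa using hg)
  have hle : ∀ s : ℝ, 0 < s → ∀ k : ℤ,
      ‖(1 / 4 : ℝ) ^ k.natAbs * a (2 ^ (k + 1) * √s)‖ ≤ (1 / 4 : ℝ) ^ k.natAbs * B := by
    intro s hs k
    rw [norm_mul, Real.norm_of_nonneg (by positivity)]
    gcongr
    exact hB _ (by have := Real.sqrt_pos.2 hs; positivity)
  refine ⟨fun s hs => Summable.of_norm_bounded hsum (hle s hs), ?_⟩
  have h := tendsto_tsum_of_dominated_convergence (𝓕 := 𝓝[>] (0 : ℝ))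
    (f := fun s k => (1 / 4 : ℝ) ^ k.natAbs * a (2 ^ (k + 1) * √s)) (g := fun _ : ℤ => (0 : ℝ))
    hsum (fun k => ?_) ?_
  · simpa using h
  · have hlim : Tendsto (fun s : ℝ => (2 : ℝ) ^ (k + 1) * √s) (𝓝[>] 0) (𝓝[>] 0) := by
      rw [tendsto_nhdsWithin_iff]
      constructor
      · have : Continuous fun s : ℝ => (2 : ℝ) ^ (k + 1) * √s := by fun_prop
        simpa using (this.tendsto 0).mono_left nhdsWithin_le_nhds
      · filter_upwards [self_mem_nhdsWithin] with s hs
        have := Real.sqrt_pos.2 (show (0 : ℝ) < s from hs)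
        show (0 : ℝ) < _
        positivity
    simpa using (ha.comp hlim).const_mul ((1 / 4 : ℝ) ^ k.natAbs)
  · filter_upwards [self_mem_nhdsWithin] with s hs k using hle s hs k

/-- At a parabolic Lebesgue point, the normalised oscillation is bounded over all radii. -/
theorem exists_integral_parabolicCylinder_div_le {E : Type*} [NormedAddCommGroup E]
    [NormedSpace ℝ E] [FiniteDimensional ℝ E] [MeasurableSpace E] [BorelSpace E]
    (μ : Measure E) [μ.IsAddHaarMeasure] {F : E × ℝ → ℝ} (hF : Integrable F (μ.prod volume))
    (p : E × ℝ) (v : ℝ)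
    (h : Tendsto
      (fun r : ℝ => (∫ q in closedBall p.1 r ×ˢ closedBall p.2 (r ^ 2), ‖F q - v‖ ∂(μ.prod volume))
        / r ^ (Module.finrank ℝ E + 2)) (𝓝[>] 0) (𝓝 0)) :
    ∃ B : ℝ, ∀ r : ℝ, 0 < r →
      ‖(∫ q in closedBall p.1 r ×ˢ closedBall p.2 (r ^ 2), ‖F q - v‖ ∂(μ.prod volume))
        / r ^ (Module.finrank ℝ E + 2)‖ ≤ B := by
  set d := Module.finrank ℝ E + 2 with hd
  set c := (μ (ball 0 1)).toReal with hc
  have hev := h.norm.eventually_le_const (show ‖(0 : ℝ)‖ < 1 by simp)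
  obtain ⟨δ, hδ, hδ'⟩ := mem_nhdsGT_iff_exists_Ioo_subset.1 hev
  have hδ : 0 < δ := hδ
  set M := ∫ q, ‖F q‖ ∂(μ.prod volume) with hM
  have hM0 : 0 ≤ M := integral_nonneg fun _ => norm_nonneg _
  refine ⟨max 1 (M / δ ^ d + |v| * (2 * c)), fun r hr => ?_⟩
  rcases lt_or_ge r δ with hrδ | hrδ
  · exact le_max_of_le_left (hδ' ⟨hr, hrδ⟩)
  apply le_max_of_le_right
  set Q := closedBall p.1 r ×ˢ closedBall p.2 (r ^ 2) with hQ
  have hvol : (μ.prod volume) Q = ENNReal.ofReal (2 * r ^ d) * μ (ball 0 1) := by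
    rw [hQ, Measure.prod_prod,
      Measure.addHaar_closedBall μ _ hr.le, Real.volume_closedBall, mul_right_comm,
      ← ENNReal.ofReal_mul (by positivity)]
    congr 2
    rw [hd]
    ring
  have hfin : (μ.prod volume) Q ≠ ⊤ := by
    rw [hvol]
    exact ENNReal.mul_ne_top ENNReal.ofReal_ne_top measure_ball_lt_top.ne
  have hcon : IntegrableOn (fun _ => |v|) Q (μ.prod volume) := integrableOn_const hfin
  have hle : ∫ q in Q, ‖F q - v‖ ∂(μ.prod volume) ≤ M + |v| * (2 * c) * r ^ d := by
    calc _ ≤ ∫ q in Q, (‖F q‖ + |v|) ∂(μ.prod volume) := by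
          apply integral_mono_of_nonneg (ae_of_all _ fun _ => norm_nonneg _)
            (hF.norm.integrableOn.add hcon) (ae_of_all _ fun q => norm_sub_le _ _)
      _ = (∫ q in Q, ‖F q‖ ∂(μ.prod volume)) + |v| * (2 * c) * r ^ d := by
          rw [integral_add hF.norm.integrableOn hcon, setIntegral_const, measureReal_def, hvol,
            ENNReal.toReal_mul, ENNReal.toReal_ofReal (by positivity), smul_eq_mul]
          ring
      _ ≤ _ := by
          gcongr
          exact setIntegral_le_integral hF.norm (ae_of_all _ fun _ => norm_nonneg _)
  rw [Real.norm_of_nonneg (div_nonneg (integral_nonneg fun _ => norm_nonneg _) (by positivity))]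
  calc _ ≤ (M + |v| * (2 * c) * r ^ d) / r ^ d := by gcongr
    _ = M / r ^ d + |v| * (2 * c) := by field_simp
    _ ≤ _ := by gcongr

theorem integrable_euclHeatKernel_prod (n : ℕ) (x : EuclideanSpace ℝ (Fin n)) (s : ℝ) :
    Integrable (fun q : EuclideanSpace ℝ (Fin n) × ℝ => euclHeatKernel n q.2 x q.1)
      (volume.prod (volume.restrict (Set.Ioo 0 s))) := by
  rw [integrable_prod_iff' (measurable_euclHeatKernel n x).aestronglyMeasurable]
  constructor
  · filter_upwards [ae_restrict_mem measurableSet_Ioo] with τ hτ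
    exact integrable_euclHeatKernel n hτ.1 x
  · have h1 : Integrable (fun _ : ℝ => (1 : ℝ)) (volume.restrict (Set.Ioo 0 s)) :=
      integrable_const 1
    refine h1.congr ?_
    filter_upwards [ae_restrict_mem measurableSet_Ioo] with τ hτ
    rw [← integral_euclHeatKernel n hτ.1 x]
    exact integral_congr_ae
      (ae_of_all _ fun y => (Real.norm_of_nonneg (euclHeatKernel_nonneg n hτ.1 x y)).symm)

theorem integral_euclHeatKernel_prod (n : ℕ) (x : EuclideanSpace ℝ (Fin n)) {s : ℝ} (hs : 0 < s) :
    ∫ q : EuclideanSpace ℝ (Fin n) × ℝ, euclHeatKernel n q.2 x q.1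
      ∂(volume.prod (volume.restrict (Set.Ioo 0 s))) = s := by
  rw [integral_prod_symm _ (integrable_euclHeatKernel_prod n x s)]
  simp only
  rw [setIntegral_congr_fun measurableSet_Ioo fun τ hτ => integral_euclHeatKernel n hτ.1 x]
  simp [hs.le]

/-- Time averages of the heat semigroup converge at every parabolic Lebesgue point. -/
theorem tendsto_average_euclHeatKernel (n : ℕ) {G : EuclideanSpace ℝ (Fin n) × ℝ → ℝ}
    (hG : Integrable G) (x : EuclideanSpace ℝ (Fin n)) (v : ℝ)
    (h : Tendsto
      (fun r : ℝ => (∫ q in closedBall x r ×ˢ closedBall 0 (r ^ 2), ‖G q - v‖) / r ^ (n + 2))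
      (𝓝[>] 0) (𝓝 0)) :
    Tendsto (fun s : ℝ => (1 / s) *
        ∫ τ in Set.Ioo (0 : ℝ) s, ∫ y, euclHeatKernel n τ x y * G (y, τ))
      (𝓝[>] 0) (𝓝 v) := by
  set a : ℝ → ℝ := fun r =>
    (∫ q in closedBall x r ×ˢ closedBall 0 (r ^ 2), ‖G q - v‖) / r ^ (n + 2) with ha
  obtain ⟨B, hB⟩ := exists_integral_parabolicCylinder_div_le volume hG (x, 0) v
    (by rw [finrank_euclideanSpace_fin]; exact h)
  simp only [finrank_euclideanSpace_fin] at hB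
  obtain ⟨hsumm, hlim⟩ := tendsto_tsum_dyadic (a := a) hB h
  obtain ⟨C, hC, hdy⟩ := exists_euclHeatKernel_dyadic_bound n
  have hlim' := hlim.const_mul C
  rw [mul_zero] at hlim'
  rw [tendsto_iff_norm_sub_tendsto_zero]
  refine squeeze_zero' (Eventually.of_forall fun _ => norm_nonneg _) ?_ hlim'
  filter_upwards [self_mem_nhdsWithin] with s hs
  have hs : 0 < s := hs
  have hss : 0 < √s := Real.sqrt_pos.2 hs
  set m : Measure (EuclideanSpace ℝ (Fin n) × ℝ) :=
    volume.prod (volume.restrict (Set.Ioo 0 s)) with hm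
  have hm_eq : m = volume.restrict (Set.univ ×ˢ Set.Ioo 0 s) := by
    rw [hm, Measure.volume_eq_prod, ← Measure.prod_restrict, Measure.restrict_univ]
  have hm_le : m ≤ volume := by
    rw [hm_eq]
    exact Measure.restrict_le_self
  have hm_mem : ∀ᵐ q ∂m, 0 < q.2 ∧ q.2 < s := by
    rw [hm_eq]
    filter_upwards [ae_restrict_mem (MeasurableSet.univ.prod measurableSet_Ioo)] with q hq
    exact hq.2
  set P : EuclideanSpace ℝ (Fin n) × ℝ → ℝ := fun q => euclHeatKernel n q.2 x q.1 with hP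
  have hPi : Integrable P m := integrable_euclHeatKernel_prod n x s
  have hGm : Integrable G m := hG.mono_measure hm_le
  set R : ℤ → ℝ := fun k => 2 ^ (k + 1) * √s with hR
  have hR0 : ∀ k, 0 < R k := fun k => by positivity
  set Q : ℤ → Set (EuclideanSpace ℝ (Fin n) × ℝ) :=
    fun k => closedBall x (R k) ×ˢ closedBall 0 (R k ^ 2) with hQ
  have hQm : ∀ k, MeasurableSet (Q k) := fun k =>
    measurableSet_closedBall.prod measurableSet_closedBall
  have ha0 : ∀ r, 0 < r → 0 ≤ a r := fun r hr =>
    div_nonneg (integral_nonneg fun _ => norm_nonneg _) (by positivity)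
  have hbd : ∫⁻ q, ‖s⁻¹ * (P q * (G q - v))‖ₑ ∂m ≤
      ENNReal.ofReal (C * ∑' k : ℤ, (1 / 4 : ℝ) ^ k.natAbs * a (R k)) := by
    calc _ ≤ ∫⁻ q, ∑' k : ℤ, ENNReal.ofReal (C * (1 / 4) ^ k.natAbs / R k ^ (n + 2)) *
            (Q k).indicator (fun q => ‖G q - v‖ₑ) q ∂m := by
          apply lintegral_mono_ae
          filter_upwards [hm_mem] with q hq
          obtain ⟨k, hk1, hk2, hk3⟩ := hdy s q.2 x q.1 hq.1 hq.2
          refine le_trans ?_ (ENNReal.le_tsum k)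
          have hqQ : q ∈ Q k := by
            refine ⟨?_, ?_⟩
            · rwa [mem_closedBall, dist_comm, dist_eq_norm]
            · rwa [mem_closedBall, Real.dist_0_eq_abs, abs_of_pos hq.1]
          rw [Set.indicator_of_mem hqQ, ← mul_assoc, enorm_mul]
          gcongr
          rw [Real.enorm_of_nonneg
            (mul_nonneg (inv_nonneg.2 hs.le) (euclHeatKernel_nonneg n hq.1 x q.1))]
          exact ENNReal.ofReal_le_ofReal hk1
      _ = ∑' k : ℤ, ENNReal.ofReal (C * (1 / 4) ^ k.natAbs / R k ^ (n + 2)) *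
            ∫⁻ q in Q k, ‖G q - v‖ₑ ∂m := by
          have hae : AEMeasurable (fun q => ‖G q - v‖ₑ) m :=
            (hGm.aestronglyMeasurable.sub aestronglyMeasurable_const).enorm
          rw [lintegral_tsum fun k => (hae.indicator (hQm k)).const_mul _]
          congr 1 with k
          rw [lintegral_const_mul'' _ (hae.indicator (hQm k)), lintegral_indicator (hQm k)]
      _ ≤ ∑' k : ℤ, ENNReal.ofReal (C * ((1 / 4) ^ k.natAbs * a (R k))) := by
          gcongr with k
          have hint : IntegrableOn (fun q => ‖G q - v‖) (Q k) := by
            refine (hG.integrableOn.sub (integrableOn_const ?_)).norm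
            exact ((isCompact_closedBall _ _).prod (isCompact_closedBall _ _)).measure_ne_top
          calc _ ≤ ENNReal.ofReal (C * (1 / 4) ^ k.natAbs / R k ^ (n + 2)) *
                ∫⁻ q in Q k, ‖G q - v‖ₑ := by
                gcongr
            _ = _ := by
                simp_rw [← ofReal_norm]
                rw [← ofReal_integral_eq_lintegral_ofReal hint
                  (ae_of_all _ fun _ => norm_nonneg _),
                  ← ENNReal.ofReal_mul (by have := hR0 k; positivity)]
                congr 1
                simp only [ha]
                ring
      _ = _ := by
          rw [← tsum_mul_left, ENNReal.ofReal_tsum_of_nonneg]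
          · exact fun k => mul_nonneg hC (mul_nonneg (by positivity) (ha0 _ (hR0 k)))
          · exact (hsumm s hs).mul_left C
  have hmeas : AEStronglyMeasurable (fun q => s⁻¹ * (P q * (G q - v))) m :=
    (hPi.aestronglyMeasurable.mul
      (hGm.aestronglyMeasurable.sub aestronglyMeasurable_const)).const_mul _
  have hint1 : Integrable (fun q => s⁻¹ * (P q * (G q - v))) m :=
    ⟨hmeas, hbd.trans_lt ENNReal.ofReal_lt_top⟩
  have hint2 : Integrable (fun q => P q * G q) m := by
    refine ((hint1.const_mul s).add (hPi.mul_const v)).congr (ae_of_all _ fun q => ?_)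
    simp only [Pi.add_apply]
    field_simp
    ring
  have hiter : ∫ τ in Set.Ioo (0 : ℝ) s, ∫ y, euclHeatKernel n τ x y * G (y, τ) =
      ∫ q, P q * G q ∂m := (integral_prod_symm _ hint2).symm
  have hdiff : (1 / s) * (∫ q, P q * G q ∂m) - v = ∫ q, s⁻¹ * (P q * (G q - v)) ∂m := by
    have h1 : ∀ q, s⁻¹ * (P q * (G q - v)) = s⁻¹ * (P q * G q) - s⁻¹ * (P q * v) :=
      fun q => by ring
    simp_rw [h1]
    rw [integral_sub (hint2.const_mul _) ((hPi.mul_const v).const_mul _), integral_const_mul,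
      integral_const_mul, integral_mul_const, integral_euclHeatKernel_prod n x hs]
    field_simp
  rw [hiter, hdiff]
  have hfinal := (enorm_integral_le_lintegral_enorm _).trans hbd
  rw [← ofReal_norm, ENNReal.ofReal_le_ofReal_iff] at hfinal
  · exact hfinal
  · exact mul_nonneg hC (tsum_nonneg fun k => mul_nonneg (by positivity) (ha0 _ (hR0 k)))

/-- Euclidean case of Proposition 6.3: for `f ∈ L¹(Ω × (0,T))` extended by zero,
for a.e. `(x,t) ∈ Ω × (0,T)`,
`(1/s) ∫₀ˢ H_τ[f(·, t-τ)](x) dτ → f(x,t)` as `s → 0⁺`. -/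
theorem heat_semigroup_lebesgue_differentiation
    (n : ℕ) (hn : 1 ≤ n)
    (Ω : Set (EuclideanSpace ℝ (Fin n))) (hΩo : IsOpen Ω)
    (hΩb : Bornology.IsBounded Ω) (T : ℝ) (hT : 0 < T)
    (f : EuclideanSpace ℝ (Fin n) → ℝ → ℝ)
    (hf_zero : ∀ x t, (x, t) ∉ Ω ×ˢ Set.Ioo 0 T → f x t = 0)
    (hf_int : Integrable (fun p : EuclideanSpace ℝ (Fin n) × ℝ => f p.1 p.2)) :
    ∀ᵐ p : EuclideanSpace ℝ (Fin n) × ℝ, p ∈ Ω ×ˢ Set.Ioo 0 T →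
      Tendsto
        (fun s : ℝ => (1 / s) *
          ∫ τ in Set.Ioo (0:ℝ) s, ∫ y, euclHeatKernel n τ p.1 y * f y (p.2 - τ))
        (nhdsWithin 0 (Set.Ioi 0)) (nhds (f p.1 p.2)) := by
  filter_upwards [ae_tendsto_integral_parabolicCylinder volume hf_int] with p hp _
  obtain ⟨x, t⟩ := p
  let ψ : EuclideanSpace ℝ (Fin n) × ℝ ≃ᵐ EuclideanSpace ℝ (Fin n) × ℝ :=
    (MeasurableEquiv.refl _).prodCongr (MeasurableEquiv.subLeft t)
  have hψ : MeasurePreserving ψ volume volume :=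
    (MeasurePreserving.id volume).prod (Measure.measurePreserving_sub_left volume t)
  have hG : Integrable (fun q : EuclideanSpace ℝ (Fin n) × ℝ => f q.1 (t - q.2)) :=
    (hψ.integrable_comp_emb ψ.measurableEmbedding).2 hf_int
  refine tendsto_average_euclHeatKernel n hG x (f x t) (hp.congr fun r => ?_)
  rw [finrank_euclideanSpace_fin, ← Measure.volume_eq_prod,
    ← hψ.setIntegral_preimage_emb ψ.measurableEmbedding]
  congr 3
  ext q
  have hψq : ψ q = (q.1, t - q.2) := rfl
  simp [hψq]
end

section
/- Let (X, d) and (Y, d_Y) be metric spaces, let u : X → Y, let x ∈ X, and let ε > 0, a > 0, r > 0. Suppose lip_r u(x) < ∞ and suppose the infimum f := inf_{y ∈ X} { a·d(x,y)²/(2ε) − d_Y(u(x), u(y)) } is attained at some point y₀ ∈ X with d(x, y₀) < r. Then f ≤ 0, d(x, y₀) ≤ (2ε/a)·lip_r u(x), and −f ≤ (2ε/a)·(lip_r u(x))². (The metric-space core of Lemma 7.7, the Hamilton–Jacobi bound relating the nonlinear flow to the pointwise Lipschitz constant.) -/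
/-- The set of difference quotients defining the truncated pointwise Lipschitz constant
`lip_r u(x) = sup_{0<s<r} sup_{d(x,y)<s} d_Y(u(x),u(y))/s`. -/
def truncLipSet {X Y : Type*} [MetricSpace X] [MetricSpace Y]
    (u : X → Y) (r : ℝ) (x : X) : Set ℝ :=
  {v : ℝ | ∃ s : ℝ, 0 < s ∧ s < r ∧ ∃ y : X, dist x y < s ∧ v = dist (u x) (u y) / s}

/-- The truncated pointwise Lipschitz constant `lip_r u(x)`. -/
noncomputable def truncLip {X Y : Type*} [MetricSpace X] [MetricSpace Y]
    (u : X → Y) (r : ℝ) (x : X) : ℝ :=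
  sSup (truncLipSet u r x)

/-- The supremum defining `truncLip u r x` is nonnegative. -/
theorem truncLip_nonneg {X Y : Type*} [MetricSpace X] [MetricSpace Y]
    (u : X → Y) (r : ℝ) (x : X) : 0 ≤ truncLip u r x := by
  refine Real.sSup_nonneg ?_
  rintro v ⟨s, hs, -, y, -, rfl⟩
  positivity

/-- Within distance `r` of `x`, `u` is Lipschitz at `x` with constant `truncLip u r x`. -/
theorem dist_le_truncLip_mul_dist {X Y : Type*} [MetricSpace X] [MetricSpace Y]
    {u : X → Y} {r : ℝ} {x y : X} (hfin : BddAbove (truncLipSet u r x)) (hy : dist x y < r) :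
    dist (u x) (u y) ≤ truncLip u r x * dist x y := by
  have hlim : Filter.Tendsto (fun s : ℝ => truncLip u r x * s) (nhdsWithin (dist x y)
      (Set.Ioi (dist x y))) (nhds (truncLip u r x * dist x y)) :=
    ((continuous_const_mul (truncLip u r x)).tendsto _).mono_left nhdsWithin_le_nhds
  refine ge_of_tendsto hlim ?_
  filter_upwards [Ioo_mem_nhdsGT hy] with s hs
  have hs0 : 0 < s := dist_nonneg.trans_lt hs.1
  exact (div_le_iff₀ hs0).mp (le_csSup hfin ⟨s, hs0, hs.2, y, hs.1, rfl⟩)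

/-- The metric-space core of Lemma 7.7: if the infimum
`f = inf_y { a d(x,y)²/(2ε) − d_Y(u(x),u(y)) }` is attained at `y₀` with `d(x,y₀) < r`
and `lip_r u(x) < ∞` (i.e. the difference quotients are bounded above), then `f ≤ 0`,
`d(x,y₀) ≤ (2ε/a)·lip_r u(x)` and `−f ≤ (2ε/a)·(lip_r u(x))²`. -/
theorem hamilton_jacobi_lip_bound {X Y : Type*} [MetricSpace X] [MetricSpace Y]
    (u : X → Y) (x : X) (ε a r : ℝ) (hε : 0 < ε) (ha : 0 < a) (hr : 0 < r)
    (hfin : BddAbove (truncLipSet u r x))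
    (f : ℝ) (y₀ : X)
    (hinf : ∀ y : X, f ≤ a * dist x y ^ 2 / (2 * ε) - dist (u x) (u y))
    (hatt : f = a * dist x y₀ ^ 2 / (2 * ε) - dist (u x) (u y₀))
    (hy₀ : dist x y₀ < r) :
    f ≤ 0 ∧ dist x y₀ ≤ (2 * ε / a) * truncLip u r x ∧
      -f ≤ (2 * ε / a) * (truncLip u r x) ^ 2 := by
  have hL := truncLip_nonneg u r x
  have hlip := dist_le_truncLip_mul_dist hfin hy₀
  have hf : f ≤ 0 := by simpa using hinf x
  have hD : dist x y₀ ≤ (2 * ε / a) * truncLip u r x := by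
    rcases (dist_nonneg (x := x) (y := y₀)).eq_or_lt with h0 | hpos
    · rw [← h0]
      positivity
    · have h : a * dist x y₀ ^ 2 / (2 * ε) ≤ truncLip u r x * dist x y₀ := by linarith
      rw [div_le_iff₀ (by positivity)] at h
      rw [div_mul_eq_mul_div, le_div_iff₀ ha]
      refine le_of_mul_le_mul_right ?_ hpos
      linarith
  refine ⟨hf, hD, ?_⟩
  have hq : 0 ≤ a * dist x y₀ ^ 2 / (2 * ε) := by positivity
  calc -f ≤ truncLip u r x * dist x y₀ := by linarith
    _ ≤ truncLip u r x * ((2 * ε / a) * truncLip u r x) := by gcongr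
    _ = (2 * ε / a) * truncLip u r x ^ 2 := by ring
end

section
/- Let (X, d) and (Y, d_Y) be metric spaces, let u : X → Y, let x ∈ X, and let M₀ > 0 be such that d_Y(u(x), u(y)) ≤ 2M₀ for all y ∈ X. Let b > 0 and ε > 0, and set C₁ := √(6M₀/b). Then inf_{y ∈ X} { b·d(x,y)²/(2ε) − d_Y(u(x), u(y)) } = inf_{y ∈ X, d(x,y) < C₁√ε} { b·d(x,y)²/(2ε) − d_Y(u(x), u(y)) }, and this common infimum lies in the interval [−2M₀, 0]. (The metric-space core of Lemma 7.1(2): the infimum defining the nonlinear Hamilton–Jacobi flow is localized to a ball of radius C₁√ε.) -/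
/-- The metric-space core of Lemma 7.1(2): the infimum defining the nonlinear
Hamilton–Jacobi flow is localized to the ball of radius `C₁√ε` with
`C₁ = √(6M₀/b)`, and the common infimum lies in `[−2M₀, 0]`. -/
theorem hamilton_jacobi_localization {X Y : Type*} [MetricSpace X] [MetricSpace Y]
    (u : X → Y) (x : X) (M₀ b ε : ℝ) (hM₀ : 0 < M₀)
    (hbound : ∀ y : X, dist (u x) (u y) ≤ 2 * M₀)
    (hb : 0 < b) (hε : 0 < ε) :
    sInf {v : ℝ | ∃ y : X, v = b * dist x y ^ 2 / (2 * ε) - dist (u x) (u y)} =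
        sInf {v : ℝ | ∃ y : X, dist x y < Real.sqrt (6 * M₀ / b) * Real.sqrt ε ∧
          v = b * dist x y ^ 2 / (2 * ε) - dist (u x) (u y)} ∧
      sInf {v : ℝ | ∃ y : X, v = b * dist x y ^ 2 / (2 * ε) - dist (u x) (u y)} ∈
        Set.Icc (-(2 * M₀)) 0 := by
  set S := {v : ℝ | ∃ y : X, v = b * dist x y ^ 2 / (2 * ε) - dist (u x) (u y)}
  set T := {v : ℝ | ∃ y : X, dist x y < Real.sqrt (6 * M₀ / b) * Real.sqrt ε ∧
    v = b * dist x y ^ 2 / (2 * ε) - dist (u x) (u y)}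
  have hTS : T ⊆ S := fun v ⟨y, _, hv⟩ => ⟨y, hv⟩
  have hT0 : (0 : ℝ) ∈ T := ⟨x, by rw [dist_self]; positivity, by simp⟩
  have hlb : ∀ v ∈ S, -(2 * M₀) ≤ v := by
    rintro v ⟨y, rfl⟩
    have h : 0 ≤ b * dist x y ^ 2 / (2 * ε) := by positivity
    linarith [hbound y]
  have hS : BddBelow S := ⟨_, hlb⟩
  have hT : BddBelow T := hS.mono hTS
  refine ⟨le_antisymm (csInf_le_csInf hS ⟨0, hT0⟩ hTS) ?_,
    le_csInf ⟨0, hTS hT0⟩ hlb, csInf_le hS (hTS hT0)⟩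
  refine le_csInf ⟨0, hTS hT0⟩ ?_
  rintro v ⟨y, rfl⟩
  by_cases hy : dist x y < Real.sqrt (6 * M₀ / b) * Real.sqrt ε
  · exact csInf_le hT ⟨y, hy, rfl⟩
  · refine (csInf_le hT hT0).trans ?_
    have hsq : 6 * M₀ / b * ε ≤ dist x y ^ 2 := by
      rw [← Real.sqrt_mul (by positivity)] at hy
      exact (Real.sqrt_le_left dist_nonneg).1 (not_lt.1 hy)
    have h : 3 * M₀ ≤ b * dist x y ^ 2 / (2 * ε) := by
      rw [le_div_iff₀ (by positivity)]
      calc 3 * M₀ * (2 * ε) = b * (6 * M₀ / b * ε) := by field_simp; norm_num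
        _ ≤ b * dist x y ^ 2 := by gcongr
    linarith [hbound y]
end

section
/- Let (X, d) and (Y, d_Y) be metric spaces, let L > 0, and let u : X → Y be L-Lipschitz, i.e. d_Y(u(x), u(y)) ≤ L·d(x,y) for all x, y ∈ X. Let a > 0, p > 1, ε > 0 and x ∈ X, and suppose the infimum f := inf_{y ∈ X} { a·d(x,y)^p/(p·ε^{p−1}) − d_Y(u(x), u(y)) } is attained at some y₀ ∈ X. Then f ≤ 0, d(x, y₀) ≤ (pL/a)^{1/(p−1)}·ε, and −f ≤ L·(pL/a)^{1/(p−1)}·ε. (The metric-space core of Lemma 8.3(2) for the p-th power Hamilton–Jacobi flow.) -/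
/-- The metric-space core of Lemma 8.3(2) for the `p`-th power Hamilton–Jacobi flow:
if `u` is `L`-Lipschitz and the infimum
`f = inf_y { a d(x,y)^p/(p ε^{p−1}) − d_Y(u(x),u(y)) }` is attained at `y₀`, then
`f ≤ 0`, `d(x,y₀) ≤ (pL/a)^{1/(p−1)} ε` and `−f ≤ L (pL/a)^{1/(p−1)} ε`. -/
theorem hamilton_jacobi_pth_power_bound {X Y : Type*} [MetricSpace X] [MetricSpace Y]
    (u : X → Y) (L : ℝ) (hL : 0 < L)
    (hlip : ∀ x y : X, dist (u x) (u y) ≤ L * dist x y)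
    (a p ε : ℝ) (ha : 0 < a) (hp : 1 < p) (hε : 0 < ε) (x : X)
    (f : ℝ) (y₀ : X)
    (hinf : ∀ y : X, f ≤ a * dist x y ^ p / (p * ε ^ (p - 1)) - dist (u x) (u y))
    (hatt : f = a * dist x y₀ ^ p / (p * ε ^ (p - 1)) - dist (u x) (u y₀)) :
    f ≤ 0 ∧ dist x y₀ ≤ (p * L / a) ^ (1 / (p - 1)) * ε ∧
      -f ≤ L * ((p * L / a) ^ (1 / (p - 1)) * ε) := by
  have hq : 0 < p - 1 := sub_pos.2 hp
  have hf : f ≤ 0 := by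
    simpa [Real.zero_rpow (zero_lt_one.trans hp).ne'] using hinf x
  have hd : dist x y₀ ≤ (p * L / a) ^ (1 / (p - 1)) * ε := by
    rcases (dist_nonneg (x := x) (y := y₀)).eq_or_lt with h | h
    · rw [← h]
      positivity
    · have hle : a * dist x y₀ ^ p / (p * ε ^ (p - 1)) ≤ L * dist x y₀ := by
        linarith [hlip x y₀]
      have hsplit : dist x y₀ ^ p = dist x y₀ ^ (p - 1) * dist x y₀ := by
        rw [← Real.rpow_add_one h.ne', sub_add_cancel]
      have hpow : (dist x y₀ / ε) ^ (p - 1) ≤ p * L / a := by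
        rw [Real.div_rpow h.le hε.le, div_le_div_iff₀ (by positivity) ha]
        rw [div_le_iff₀ (by positivity), hsplit] at hle
        refine le_of_mul_le_mul_right ?_ h
        linarith
      rw [← div_le_iff₀ hε, one_div]
      exact (Real.le_rpow_inv_iff_of_pos (by positivity) (by positivity) hq).2 hpow
  refine ⟨hf, hd, ?_⟩
  have hnonneg : 0 ≤ a * dist x y₀ ^ p / (p * ε ^ (p - 1)) := by positivity
  linarith [hlip x y₀, mul_le_mul_of_nonneg_left hd hL.le]
end

section
/- Let (X, d) be a nonempty metric space with diameter at most D, let (Y, d_Y) be a metric space, let I ⊂ ℝ be an interval, and let u : X × I → Y satisfy: (i) d_Y(u(y,t), u(y,t')) ≤ c_L·|t−t'| for all y ∈ X and t, t' ∈ I, and (ii) d_Y(u(x,t), u(y,t)) ≤ 2M₀ for all x, y ∈ X and t ∈ I, for constants c_L ≥ 0 and M₀ > 0. Let a : I → ℝ satisfy 0 < a(t) ≤ A and |a(t) − a(t')| ≤ A'·|t−t'| for all t, t' ∈ I, for constants A > 0, A' ≥ 0. For ε > 0 define f_ε(x,t) := inf_{y ∈ X} { a(t)·d(x,y)²/(2ε)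 − d_Y(u(x,t), u(y,t)) }. Then for all x, x' ∈ X and t, t' ∈ I, |f_ε(x,t) − f_ε(x',t')| ≤ (A'·D²/(2ε) + c_L)·|t−t'| + (A·D/ε)·d(x,x') + d_Y(u(x,t), u(x',t')). (The metric-space core of the continuity estimate in Lemma 7.1(3) for the nonlinear Hamilton–Jacobi flow.) -/
/-- Moving the base point and the coefficient in the penalty `α r²`. -/
theorem mul_sq_sub_mul_sq_le {α β A L r s D δ : ℝ} (hβ : 0 ≤ β) (hβA : β ≤ A)
    (hαβ : |α - β| ≤ L) (hr : 0 ≤ r) (hrD : r ≤ D) (hs : 0 ≤ s) (hsD : s ≤ D)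
    (hδ : 0 ≤ δ) (hrs : r ≤ s + δ) :
    α * r ^ 2 - β * s ^ 2 ≤ L * D ^ 2 + 2 * A * D * δ := by
  have hL : 0 ≤ L := (abs_nonneg _).trans hαβ
  have h₁ : (α - β) * r ^ 2 ≤ L * D ^ 2 :=
    mul_le_mul ((le_abs_self _).trans hαβ) (by gcongr) (sq_nonneg r) hL
  have h₂ : r ^ 2 - s ^ 2 ≤ 2 * D * δ := by
    calc r ^ 2 - s ^ 2 = (r + s) * (r - s) := by ring
      _ ≤ (r + s) * δ := by gcongr; linarith
      _ ≤ 2 * D * δ := by gcongr; linarith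
  have hD : 0 ≤ D := hr.trans hrD
  have h₃ : β * (r ^ 2 - s ^ 2) ≤ A * (2 * D * δ) :=
    calc β * (r ^ 2 - s ^ 2) ≤ β * (2 * D * δ) := by gcongr
      _ ≤ A * (2 * D * δ) := by gcongr
  linarith

/-- The metric-space core of the continuity estimate in Lemma 7.1(3) for the
nonlinear Hamilton–Jacobi flow
`f_ε(x,t) = inf_y { a(t) d(x,y)²/(2ε) − d_Y(u(x,t), u(y,t)) }`. -/
theorem hamilton_jacobi_continuity {X Y : Type*} [MetricSpace X] [MetricSpace Y]
    [Nonempty X]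
    (D : ℝ) (hD : ∀ x y : X, dist x y ≤ D)
    (I : Set ℝ) (hI : I.OrdConnected)
    (u : X → ℝ → Y) (cL M₀ : ℝ) (hcL : 0 ≤ cL) (hM₀ : 0 < M₀)
    (hu_time : ∀ y : X, ∀ t ∈ I, ∀ t' ∈ I, dist (u y t) (u y t') ≤ cL * |t - t'|)
    (hu_bdd : ∀ x y : X, ∀ t ∈ I, dist (u x t) (u y t) ≤ 2 * M₀)
    (a : ℝ → ℝ) (A A' : ℝ) (hA : 0 < A) (hA' : 0 ≤ A')
    (ha_pos : ∀ t ∈ I, 0 < a t) (ha_bdd : ∀ t ∈ I, a t ≤ A)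
    (ha_lip : ∀ t ∈ I, ∀ t' ∈ I, |a t - a t'| ≤ A' * |t - t'|)
    (ε : ℝ) (hε : 0 < ε)
    (f : X → ℝ → ℝ)
    (hf : ∀ x t, f x t = sInf {v : ℝ | ∃ y : X,
      v = a t * dist x y ^ 2 / (2 * ε) - dist (u x t) (u y t)}) :
    ∀ (x x' : X), ∀ t ∈ I, ∀ t' ∈ I,
      |f x t - f x' t'| ≤ (A' * D ^ 2 / (2 * ε) + cL) * |t - t'|
        + (A * D / ε) * dist x x' + dist (u x t) (u x' t') := by
  have one_sided : ∀ (x x' : X), ∀ t ∈ I, ∀ t' ∈ I,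
      f x t - f x' t' ≤ (A' * D ^ 2 / (2 * ε) + cL) * |t - t'|
        + (A * D / ε) * dist x x' + dist (u x t) (u x' t') := by
    intro x x' t ht t' ht'
    rw [sub_le_comm, hf x' t']
    refine le_csInf ⟨_, Classical.arbitrary X, rfl⟩ ?_
    rintro _ ⟨y, rfl⟩
    have hle : f x t ≤ a t * dist x y ^ 2 / (2 * ε) - dist (u x t) (u y t) := by
      rw [hf x t]
      refine csInf_le ⟨-(2 * M₀), ?_⟩ ⟨y, rfl⟩
      rintro _ ⟨z, rfl⟩
      have hz : 0 ≤ a t * dist x z ^ 2 / (2 * ε) := by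
        have := ha_pos t ht
        positivity
      linarith [hu_bdd x z t ht]
    have hpen : a t * dist x y ^ 2 / (2 * ε) - a t' * dist x' y ^ 2 / (2 * ε)
        ≤ A' * D ^ 2 / (2 * ε) * |t - t'| + A * D / ε * dist x x' := by
      have h := mul_sq_sub_mul_sq_le (ha_pos t' ht').le (ha_bdd t' ht')
        (ha_lip t ht t' ht') dist_nonneg (hD x y) dist_nonneg (hD x' y)
        (dist_nonneg (x := x) (y := x'))
        ((dist_triangle x x' y).trans_eq (add_comm _ _))
      calc _ = (a t * dist x y ^ 2 - a t' * dist x' y ^ 2) / (2 * ε) := by ring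
        _ ≤ (A' * |t - t'| * D ^ 2 + 2 * A * D * dist x x') / (2 * ε) := by gcongr
        _ = _ := by field_simp
    have htri := dist_triangle4 (u x' t') (u x t) (u y t) (u y t')
    rw [dist_comm (u x' t') (u x t)] at htri
    linarith [hu_time y t ht t' ht']
  intro x x' t ht t' ht'
  refine abs_sub_le_iff.2 ⟨one_sided x x' t ht t' ht', ?_⟩
  simpa only [abs_sub_comm t' t, dist_comm x' x, dist_comm (u x' t') (u x t)] using
    one_sided x' x t' ht' t ht
end
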